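/- Let V = (Σᵢ Vᵢ)|_φ be the constrained composition under φ of an indexed family {Vᵢ}ᵢ₌₁ⁿ of VLSMs over the same message set, and let j ∈ {1,…,n}. The projection on component j of any valid trace of V is a valid trace of the induced j-th projection Proj_j(V). -/

import Mathlib

set_option autoImplicit false

universe u v w

/-- A validating labelled state transition and message production system (VLSM):
labels, a nonempty set of initial states, initial messages, a total transition
function and a validity constraint.  `Option M` plays the role of `M ∪ {⊥}`. -/
structure VLSM (L : Type u) (S : Type v) (M : Type w) where
  init : Set S
  init_ne : init.Nonempty
  initMsg : Set M
  tau : L → S → Option M → S × Option M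
  beta : L → S → Option M → Prop

/-- A transition record: label, source state, input message, target state, output message. -/
structure VTrans (L : Type u) (S : Type v) (M : Type w) where
  lbl : L
  src : S
  msg : Option M
  dst : S
  out : Option M

variable {L : Type u} {S : Type v} {M : Type w}

/-- `Chain s tr sf`: the transitions of `tr` link up, starting at `s` and ending at `sf`. -/
def Chain : S → List (VTrans L S M) → S → Prop
  | s, [], sf => s = sf
  | s, t :: ts, sf => t.src = s ∧ Chain t.dst ts sf

namespace VLSM

/-- `t` is an actual transition of `V` (the transition function agrees with `t`). -/
def IsTrans (V : VLSM L S M) (t : VTrans L S M) : Prop :=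
  V.tau t.lbl t.src t.msg = (t.dst, t.out)

/-- `t` is a constrained transition of `V`. -/
def IsConstrainedTrans (V : VLSM L S M) (t : VTrans L S M) : Prop :=
  V.IsTrans t ∧ V.beta t.lbl t.src t.msg

/-- `tr` is a constrained trace of `V` reaching the state `sf`. -/
def ConstrainedTraceTo (V : VLSM L S M) (tr : List (VTrans L S M)) (sf : S) : Prop :=
  (∀ t ∈ tr, V.IsConstrainedTrans t) ∧ ∃ s0 ∈ V.init, Chain s0 tr sf

/-- A state is constrained if some constrained trace reaches it. -/
def ConstrainedState (V : VLSM L S M) (s : S) : Prop :=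
  ∃ tr, V.ConstrainedTraceTo tr s

/-- Constrained reachability, defined inductively (a state is constrained iff it is
reachable from an initial state by constrained transitions). -/
inductive ReachState (V : VLSM L S M) : S → Prop where
  | init {s} : s ∈ V.init → ReachState V s
  | step {l s m} : ReachState V s → V.beta l s m → ReachState V (V.tau l s m).1

mutual
  /-- Valid states of a VLSM. -/
  inductive ValidState (V : VLSM L S M) : S → Prop where
    | init {s} : s ∈ V.init → ValidState V s
    | step {l s m} : ValidState V s → ValidOMsg V m → V.beta l s m →
        ValidState V (V.tau l s m).1
  /-- Valid optional messages of a VLSM (`none` is always valid). -/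
  inductive ValidOMsg (V : VLSM L S M) : Option M → Prop where
    | none : ValidOMsg V Option.none
    | init {m} : m ∈ V.initMsg → ValidOMsg V (some m)
    | step {l s m} : ValidState V s → ValidOMsg V m → V.beta l s m →
        ValidOMsg V (V.tau l s m).2
end

/-- `t` is a valid transition of `V`. -/
def IsValidTrans (V : VLSM L S M) (t : VTrans L S M) : Prop :=
  V.IsConstrainedTrans t ∧ V.ValidState t.src ∧ V.ValidOMsg t.msg

/-- `tr` is a valid trace of `V` reaching the state `sf`. -/
def ValidTraceTo (V : VLSM L S M) (tr : List (VTrans L S M)) (sf : S) : Prop :=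
  (∀ t ∈ tr, V.IsValidTrans t) ∧ ∃ s0 ∈ V.init, Chain s0 tr sf

/-- `tr` is a valid trace of `V`. -/
def IsValidTrace (V : VLSM L S M) (tr : List (VTrans L S M)) : Prop :=
  ∃ sf, V.ValidTraceTo tr sf

end VLSM

/-- The message `m` is emitted (sent) on the trace `tr`. -/
def EmittedOn (tr : List (VTrans L S M)) (m : M) : Prop := ∃ t ∈ tr, t.out = some m

/-- The message `m` is received on the trace `tr`. -/
def ReceivedOn (tr : List (VTrans L S M)) (m : M) : Prop := ∃ t ∈ tr, t.msg = some m

/-- `sent` is a sent-oracle for `V`: at every constrained state `s`, `sent s m` holds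
iff `m` is emitted on every constrained trace reaching `s`. -/
def IsSentOracle (V : VLSM L S M) (sent : S → M → Prop) : Prop :=
  ∀ s, V.ConstrainedState s → ∀ m,
    (sent s m ↔ ∀ tr, V.ConstrainedTraceTo tr s → EmittedOn tr m)

/-- `recv` is a received-oracle for `V`. -/
def IsReceivedOracle (V : VLSM L S M) (recv : S → M → Prop) : Prop :=
  ∀ s, V.ConstrainedState s → ∀ m,
    (recv s m ↔ ∀ tr, V.ConstrainedTraceTo tr s → ReceivedOn tr m)

/-- The full node assumption: whenever receiving `m` is allowed by the validity
constraint, every direct dependency of `m` has been directly observed in the state. -/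
def FullNodeAssumption (V : VLSM L S M) (dep : M → M → Prop)
    (sent recv : S → M → Prop) : Prop :=
  ∀ l s m, V.beta l s (some m) → ∀ m', dep m' m → sent s m' ∨ recv s m'

section Composition

variable {ι : Type*} [DecidableEq ι] {Lf : ι → Type*} {Sf : ι → Type*}

/-- The constrained composition of an indexed family of VLSMs over the same
message set, under the composition constraint `φ`. -/
noncomputable def comp (V : ∀ i, VLSM (Lf i) (Sf i) M)
    (φ : (Σ i, Lf i) → (∀ i, Sf i) → Option M → Prop) :
    VLSM (Σ i, Lf i) (∀ i, Sf i) M where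
  init := {σ | ∀ i, σ i ∈ (V i).init}
  init_ne := ⟨fun i => ((V i).init_ne).choose, fun i => ((V i).init_ne).choose_spec⟩
  initMsg := ⋃ i, (V i).initMsg
  tau := fun l σ m =>
    (Function.update σ l.1 ((V l.1).tau l.2 (σ l.1) m).1, ((V l.1).tau l.2 (σ l.1) m).2)
  beta := fun l σ m => (V l.1).beta l.2 (σ l.1) m ∧ φ l σ m

/-- The free composition of an indexed family of VLSMs over the same message set. -/
noncomputable def freeComp (V : ∀ i, VLSM (Lf i) (Sf i) M) :
    VLSM (Σ i, Lf i) (∀ i, Sf i) M :=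
  comp V fun _ _ _ => True

/-- Component `j` is a validator for the composite VLSM `W`: every constrained
transition from a constrained state of `V j` lifts to a valid transition of `W`
with matching `j`-th state components and matching input/output messages. -/
def IsValidatorAt (V : ∀ i, VLSM (Lf i) (Sf i) M)
    (W : VLSM (Σ i, Lf i) (∀ i, Sf i) M) (j : ι) : Prop :=
  ∀ l s m, (V j).ConstrainedState s → (V j).beta l s m →
    ∃ σ : ∀ i, Sf i, σ j = s ∧
      W.IsValidTrans ⟨⟨j, l⟩, σ, m, (W.tau ⟨j, l⟩ σ m).1, (W.tau ⟨j, l⟩ σ m).2⟩ ∧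
      (W.tau ⟨j, l⟩ σ m).1 j = ((V j).tau l s m).1 ∧
      (W.tau ⟨j, l⟩ σ m).2 = ((V j).tau l s m).2

/-- The induced `j`-th projection of a composite VLSM `W`: the same VLSM as the
component `Vj`, except that its initial messages are all valid messages of `W`. -/
def projV {L' : Type*} {S' : Type*} {L2 : Type*} {S2 : Type*}
    (Vj : VLSM L' S' M) (W : VLSM L2 S2 M) : VLSM L' S' M :=
  { Vj with initMsg := {m | W.ValidOMsg (some m)} }

/-- The projection of a composite trace on component `j`. -/
def projTrace (j : ι) (tr : List (VTrans (Σ i, Lf i) (∀ i, Sf i) M)) :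
    List (VTrans (Lf j) (Sf j) M) :=
  tr.filterMap fun t =>
    if h : t.lbl.1 = j then some ⟨h ▸ t.lbl.2, t.src j, t.msg, t.dst j, t.out⟩ else none

/-- The composition constraint of the fixed-set message-equivocation model:
the only message-equivocations allowed are among the components of `E`. -/
def phiM (sender : M → ι) (sent : ∀ i, Sf i → M → Prop) (E : Set ι) :
    (Σ i, Lf i) → (∀ i, Sf i) → Option M → Prop :=
  fun l σ m => ∀ mm, m = some mm →
    (sent (sender mm) (σ (sender mm)) mm ∨ (l.1 ∈ E ∧ sender mm ∈ E))

end Composition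

/-- Labels of the equivocating VLSM associated to a VLSM: act as the `i`-th copy,
duplicate the `i`-th copy, or spawn a new machine after position `i` (1-based). -/
inductive ELabel (L : Type u) (S : Type v) where
  | act (i : ℕ) (l : L)
  | dup (i : ℕ)
  | new (i : ℕ) (s : S)

/-- The equivocating VLSM associated to a VLSM `V`: its states are (nonempty) lists
of states of `V`, and it can fork itself or spawn fresh copies at any moment. -/
noncomputable def eVLSM (V : VLSM L S M) : VLSM (ELabel L S) (List S) M where
  init := {γ | ∃ s ∈ V.init, γ = [s]}
  init_ne := ⟨[V.init_ne.choose], V.init_ne.choose, V.init_ne.choose_spec, rfl⟩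
  initMsg := V.initMsg
  tau := fun lab γ m =>
    match lab with
    | .act i l =>
      match γ[i - 1]? with
      | some s => (γ.set (i - 1) (V.tau l s m).1, (V.tau l s m).2)
      | none => (γ, Option.none)
    | .dup i =>
      match γ[i - 1]? with
      | some s => (γ.take i ++ s :: γ.drop i, Option.none)
      | none => (γ, Option.none)
    | .new i s0 => (γ.take i ++ s0 :: γ.drop i, Option.none)
  beta := fun lab γ m =>
    match lab with
    | .act i l => 1 ≤ i ∧ i ≤ γ.length ∧ ∃ s, γ[i - 1]? = some s ∧ V.beta l s m
    | .dup i => 1 ≤ i ∧ i ≤ γ.length ∧ m = Option.none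
    | .new i s0 => 1 ≤ i ∧ i ≤ γ.length ∧ m = Option.none ∧ s0 ∈ V.init

section Projection

variable {ι : Type*} [DecidableEq ι] {Lf : ι → Type*} {Sf : ι → Type*}

theorem projTrace_cons_self (j : ι) (l : Lf j) (σ σ' : ∀ i, Sf i) (m m' : Option M)
    (tr : List (VTrans (Σ i, Lf i) (∀ i, Sf i) M)) :
    projTrace j (⟨⟨j, l⟩, σ, m, σ', m'⟩ :: tr) =
      ⟨l, σ j, m, σ' j, m'⟩ :: projTrace j tr := by
  simp [projTrace]

theorem projTrace_cons_of_ne (j : ι) {t : VTrans (Σ i, Lf i) (∀ i, Sf i) M}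
    (ht : t.lbl.1 ≠ j) (tr : List (VTrans (Σ i, Lf i) (∀ i, Sf i) M)) :
    projTrace j (t :: tr) = projTrace j tr := by
  simp [projTrace, ht]

theorem VLSM.ValidOMsg.projV {L' : Type*} {S' : Type*} {L2 : Type*} {S2 : Type*}
    (Vj : VLSM L' S' M) {W : VLSM L2 S2 M} {m : Option M} (hm : W.ValidOMsg m) :
    (projV Vj W).ValidOMsg m := by
  cases m with
  | none => exact .none
  | some m => exact .init hm

/-- A transition on a component other than `j` leaves the `j`-th state component unchanged. -/
theorem comp_dst_eq_src_of_ne (V : ∀ i, VLSM (Lf i) (Sf i) M)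
    (φ : (Σ i, Lf i) → (∀ i, Sf i) → Option M → Prop) {j : ι}
    {t : VTrans (Σ i, Lf i) (∀ i, Sf i) M} (h : (comp V φ).IsTrans t) (ht : t.lbl.1 ≠ j) :
    t.dst j = t.src j := by
  have hd : Function.update t.src t.lbl.1 _ = t.dst := congrArg Prod.fst h
  rw [← hd, Function.update_of_ne ht.symm]

/-- A transition on component `j` projects to a transition of that component. -/
theorem isConstrainedTrans_proj (V : ∀ i, VLSM (Lf i) (Sf i) M)
    (φ : (Σ i, Lf i) → (∀ i, Sf i) → Option M → Prop) {j : ι} {l : Lf j}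
    {σ σ' : ∀ i, Sf i} {m m' : Option M}
    (h : (comp V φ).IsConstrainedTrans ⟨⟨j, l⟩, σ, m, σ', m'⟩) :
    (V j).IsConstrainedTrans ⟨l, σ j, m, σ' j, m'⟩ := by
  obtain ⟨ht, hb, -⟩ := h
  have hd : Function.update σ j _ = σ' := congrArg Prod.fst ht
  have ho : ((V j).tau l (σ j) m).2 = m' := congrArg Prod.snd ht
  refine ⟨Prod.ext ?_ ho, hb⟩
  rw [← hd, Function.update_self]

/-- Projecting a chain of valid transitions whose starting state has a valid `j`-th component. -/
theorem isValidTrans_and_chain_projTrace (V : ∀ i, VLSM (Lf i) (Sf i) M)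
    (φ : (Σ i, Lf i) → (∀ i, Sf i) → Option M → Prop) (j : ι)
    (tr : List (VTrans (Σ i, Lf i) (∀ i, Sf i) M)) (σ σf : ∀ i, Sf i)
    (htr : ∀ t ∈ tr, (comp V φ).IsValidTrans t) (hc : Chain σ tr σf)
    (hσ : (projV (V j) (comp V φ)).ValidState (σ j)) :
    (∀ t ∈ projTrace j tr, (projV (V j) (comp V φ)).IsValidTrans t) ∧
      Chain (σ j) (projTrace j tr) (σf j) := by
  induction tr generalizing σ with
  | nil => exact ⟨by simp [projTrace], congrFun hc j⟩
  | cons t tr ih =>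
    obtain ⟨rfl, hc⟩ := hc
    obtain ⟨ht, hts⟩ := List.forall_mem_cons.1 htr
    by_cases hj : t.lbl.1 = j
    · obtain ⟨⟨i, l⟩, σ, m, σ', m'⟩ := t
      obtain rfl : i = j := hj
      have hp : (projV (V i) (comp V φ)).IsConstrainedTrans ⟨l, σ i, m, σ' i, m'⟩ :=
        isConstrainedTrans_proj V φ ht.1
      have hm := ht.2.2.projV (V i)
      have hσ' : (projV (V i) (comp V φ)).ValidState (σ' i) := by
        have hs := VLSM.ValidState.step hσ hm hp.2
        rwa [show (projV (V i) (comp V φ)).tau l (σ i) m = (σ' i, m') from hp.1] at hs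
      obtain ⟨hv, hch⟩ := ih σ' hts hc hσ'
      rw [projTrace_cons_self]
      exact ⟨List.forall_mem_cons.2 ⟨⟨hp, hσ, hm⟩, hv⟩, rfl, hch⟩
    · have he := comp_dst_eq_src_of_ne V φ ht.1.1 hj
      rw [projTrace_cons_of_ne j hj, ← he]
      exact ih t.dst hts hc (he ▸ hσ)

end Projection

/-- The projection on component `j` of a valid trace of a constrained composition
is a valid trace of the induced `j`-th projection. -/
theorem valid_trace_projects {ι : Type} [DecidableEq ι] {Lf Sf : ι → Type} {M : Type}
    (V : ∀ i, VLSM (Lf i) (Sf i) M)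
    (φ : (Σ i, Lf i) → (∀ i, Sf i) → Option M → Prop) (j : ι)
    (tr : List (VTrans (Σ i, Lf i) (∀ i, Sf i) M))
    (h : (comp V φ).IsValidTrace tr) :
    (projV (V j) (comp V φ)).IsValidTrace (projTrace j tr) := by
  obtain ⟨σf, htr, σ₀, h₀, hc⟩ := h
  obtain ⟨hv, hch⟩ := isValidTrans_and_chain_projTrace V φ j tr σ₀ σf htr hc (.init (h₀ j))
  exact ⟨σf j, hv, σ₀ j, h₀ j, hch⟩
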